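/- arXiv:1802.06895 — 2 statements merged into one kernel-verified Lean document; each statement's English description precedes it below -/
import Mathlib

section
/- (Monotonicity direction of Proposition 5 of the paper.) For every abstraction set Λ ⊆ 𝕡, foil set F, and explanation sets E₁ ⊆ E₂ ⊆ 𝕡, the foils resolved by E₁ are also resolved by E₂: R_F(Λ, E₁) ⊆ R_F(Λ, E₂). In particular, for any two propositions p₁, p₂ ∈ 𝕡, R_F(Λ, {p₁}) ∪ R_F(Λ, {p₂}) ⊆ R_F(Λ, {p₁, p₂}). -/
/-- Projection abstraction of a labeled transition system on states `Set P`
with action labels `A`, with respect to a set `Λ` of propositions. -/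
def AbsT {P A : Type*} (T : Set P → A → Set P → Prop) (Λ : Set P) :
    Set P → A → Set P → Prop :=
  fun s₁ a s₂ => ∃ t₁ t₂, T t₁ a t₂ ∧ s₁ = t₁ \ Λ ∧ s₂ = t₂ \ Λ

/-- A plan (list of action labels) is valid for transition system `T`, initial
state `I` and goal `G` iff following transitions of `T` along the plan from `I`
can reach a state containing `G`. -/
def ValidPlan {P A : Type*} (T : Set P → A → Set P → Prop) (I G : Set P) :
    List A → Prop
  | [] => G ⊆ I
  | a :: π => ∃ s, T I a s ∧ ValidPlan T s G π

/-- For the base task `(T, I, G)` and foil set `F`, the resolution set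
`R_F(Λ, E)` is the set of foils in `F` that are not valid in the task
abstracted by `Λ \ E`. -/
def ResSet {P A : Type*} (T : Set P → A → Set P → Prop) (I G : Set P)
    (F : Set (List A)) (Λ E : Set P) : Set (List A) :=
  {π ∈ F | ¬ ValidPlan (AbsT T (Λ \ E)) (I \ (Λ \ E)) (G \ (Λ \ E)) π}

theorem sdiff_sdiff_of_subset {P : Type*} {Λ₁ Λ₂ : Set P} (h : Λ₁ ⊆ Λ₂) (t : Set P) :
    (t \ Λ₁) \ Λ₂ = t \ Λ₂ := by
  rw [Set.sdiff_sdiff, Set.union_eq_self_of_subset_left h]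

theorem AbsT.coarsen {P A : Type*} {T : Set P → A → Set P → Prop} {Λ₁ Λ₂ : Set P}
    (h : Λ₁ ⊆ Λ₂) {s₁ s₂ : Set P} {a : A} (hT : AbsT T Λ₁ s₁ a s₂) :
    AbsT T Λ₂ (s₁ \ Λ₂) a (s₂ \ Λ₂) := by
  obtain ⟨t₁, t₂, ht, rfl, rfl⟩ := hT
  exact ⟨t₁, t₂, ht, sdiff_sdiff_of_subset h t₁, sdiff_sdiff_of_subset h t₂⟩

theorem ValidPlan.sdiff_of_simulation {P A : Type*} {T T' : Set P → A → Set P → Prop}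
    {Λ : Set P} (hT : ∀ s a s', T s a s' → T' (s \ Λ) a (s' \ Λ)) {G : Set P} :
    ∀ {π : List A} {I : Set P}, ValidPlan T I G π → ValidPlan T' (I \ Λ) (G \ Λ) π
  | [], _, h => Set.sdiff_subset_sdiff_left h
  | _ :: _, _, ⟨s, hs, h⟩ => ⟨s \ Λ, hT _ _ _ hs, h.sdiff_of_simulation hT⟩

/-- A plan valid in an abstract task stays valid in every coarser abstraction. -/
theorem ValidPlan.abs_mono {P A : Type*} {T : Set P → A → Set P → Prop} {I G Λ₁ Λ₂ : Set P}
    (h : Λ₁ ⊆ Λ₂) {π : List A} (hπ : ValidPlan (AbsT T Λ₁) (I \ Λ₁) (G \ Λ₁) π) :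
    ValidPlan (AbsT T Λ₂) (I \ Λ₂) (G \ Λ₂) π := by
  simpa only [sdiff_sdiff_of_subset h] using
    hπ.sdiff_of_simulation (T' := AbsT T Λ₂) (Λ := Λ₂) fun _ _ _ hT => hT.coarsen h

theorem ResSet.subset_of_subset {P A : Type*} (T : Set P → A → Set P → Prop) (I G : Set P)
    (F : Set (List A)) (Λ : Set P) {E₁ E₂ : Set P} (h : E₁ ⊆ E₂) :
    ResSet T I G F Λ E₁ ⊆ ResSet T I G F Λ E₂ :=
  fun _ hπ => ⟨hπ.1, fun hv => hπ.2 (hv.abs_mono (Set.sdiff_subset_sdiff_right h))⟩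

/-- Monotonicity of resolution sets (Proposition 5, monotonicity direction):
for `E₁ ⊆ E₂ ⊆ 𝕡`, every foil resolved by `E₁` is resolved by `E₂`; in
particular `R_F(Λ, {p₁}) ∪ R_F(Λ, {p₂}) ⊆ R_F(Λ, {p₁, p₂})`. -/
theorem resSet_mono {P A : Type*} (T : Set P → A → Set P → Prop)
    (I G 𝕡 : Set P) (F : Set (List A)) (Λ : Set P) (hΛ : Λ ⊆ 𝕡) :
    (∀ E₁ E₂ : Set P, E₁ ⊆ E₂ → E₂ ⊆ 𝕡 →
      ResSet T I G F Λ E₁ ⊆ ResSet T I G F Λ E₂) ∧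
    (∀ p₁ ∈ 𝕡, ∀ p₂ ∈ 𝕡,
      ResSet T I G F Λ {p₁} ∪ ResSet T I G F Λ {p₂} ⊆
        ResSet T I G F Λ {p₁, p₂}) := by
  refine ⟨fun _ _ h _ => ResSet.subset_of_subset T I G F Λ h, fun p₁ _ p₂ _ => ?_⟩
  exact Set.union_subset (ResSet.subset_of_subset T I G F Λ (by simp))
    (ResSet.subset_of_subset T I G F Λ (by simp))
end

section
/- (Proposition 6 of the paper, stated with the provable orientation.) Let Λ₁ ⊆ Λ₂ ⊆ 𝕡, so that the abstract model at Λ₂ is an abstraction of the abstract model at Λ₁. Then for every proposition p ∈ 𝕡 and every foil set F, any foil resolved by concretizing p in the more abstract model is also resolved by concretizing p in the less abstract model: R_F(Λ₂, {p}) ⊆ R_F(Λ₁, {p}). -/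
theorem Set.sdiff_sdiff_of_subset {P : Type*} {Λ Λ' : Set P} (h : Λ ⊆ Λ') (s : Set P) :
    (s \ Λ) \ Λ' = s \ Λ' := by
  rw [sdiff_sdiff_left, sup_eq_right.mpr h]

theorem AbsT.mono {P A : Type*} {T : Set P → A → Set P → Prop} {Λ Λ' : Set P}
    (h : Λ ⊆ Λ') {s₁ s₂ : Set P} {a : A} (hT : AbsT T Λ s₁ a s₂) :
    AbsT T Λ' (s₁ \ Λ') a (s₂ \ Λ') := by
  obtain ⟨t₁, t₂, ht, rfl, rfl⟩ := hT
  exact ⟨t₁, t₂, ht, Set.sdiff_sdiff_of_subset h t₁, Set.sdiff_sdiff_of_subset h t₂⟩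

/-- A plan valid in a projection abstraction stays valid in every coarser one. -/
theorem ValidPlan.absT_mono {P A : Type*} {T : Set P → A → Set P → Prop} {Λ Λ' : Set P}
    (h : Λ ⊆ Λ') {s G : Set P} {π : List A} (hπ : ValidPlan (AbsT T Λ) s G π) :
    ValidPlan (AbsT T Λ') (s \ Λ') (G \ Λ') π := by
  induction π generalizing s with
  | nil => exact fun x hx => ⟨hπ hx.1, hx.2⟩
  | cons a π ih =>
    obtain ⟨s', hs, hπ⟩ := hπ
    exact ⟨s' \ Λ', hs.mono h, ih hπ⟩

/-- Proposition 6: if `Λ₁ ⊆ Λ₂ ⊆ 𝕡`, then for every `p ∈ 𝕡` any foil resolved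
by concretizing `p` in the more abstract model (at `Λ₂`) is also resolved by
concretizing `p` in the less abstract model (at `Λ₁`). -/
theorem resSet_antitone_in_model {P A : Type*} (T : Set P → A → Set P → Prop)
    (I G 𝕡 : Set P) (F : Set (List A)) (Λ₁ Λ₂ : Set P)
    (h₁₂ : Λ₁ ⊆ Λ₂) (h₂ : Λ₂ ⊆ 𝕡) (p : P) (hp : p ∈ 𝕡) :
    ResSet T I G F Λ₂ {p} ⊆ ResSet T I G F Λ₁ {p} := by
  rintro π ⟨hF, hπ⟩
  refine ⟨hF, fun hv => hπ ?_⟩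
  have h : Λ₁ \ {p} ⊆ Λ₂ \ {p} := fun x hx => ⟨h₁₂ hx.1, hx.2⟩
  simpa only [Set.sdiff_sdiff_of_subset h] using hv.absT_mono h
end
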